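/- With notation as in the class C_n (three-colored loopless multigraphs on n vertices, at most one edge of each color between any pair of vertices, and the function Σ defined via the two-color subgraphs Γ_my, Γ_yc, Γ_mc): Σ(Γ) = n if and only if every cycle of Γ is monochromatic (different cycles may have different colors). -/

import Mathlib

/-- The three edge colors for graphs in the class `C_n`. -/
inductive Col : Type
  | magenta | yellow | cyan
  deriving DecidableEq

/-- A three-colored loopless multigraph with at most one edge of each color between
any pair of vertices is the same data as three simple graphs `Gm`, `Gy`, `Gc`
(the magenta, yellow and cyan edges).  `colG Gm Gy Gc x` is the simple graph of
edges of color `x`. -/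
def colG {V : Type*} (Gm Gy Gc : SimpleGraph V) : Col → SimpleGraph V
  | Col.magenta => Gm
  | Col.yellow => Gy
  | Col.cyan => Gc

open scoped Classical in
/-- The function `Σ(Γ) = ∑_{C ∈ CC(Γ)} (val_my C + val_yc C + val_mc C - 2)`,
where `val_colors C` is the number of connected components of the induced subgraph
of the two-colored subgraph `Γ_colors` on the vertex set of the component `C`. -/
noncomputable def SigmaFn {V : Type*} [Fintype V] (Gm Gy Gc : SimpleGraph V) : ℕ :=
  ∑ C : (Gm ⊔ Gy ⊔ Gc).ConnectedComponent,
    (Fintype.card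
        ((Gm ⊔ Gy).induce {v : V | (Gm ⊔ Gy ⊔ Gc).connectedComponentMk v = C}).ConnectedComponent
      + Fintype.card
        ((Gy ⊔ Gc).induce {v : V | (Gm ⊔ Gy ⊔ Gc).connectedComponentMk v = C}).ConnectedComponent
      + Fintype.card
        ((Gm ⊔ Gc).induce {v : V | (Gm ⊔ Gy ⊔ Gc).connectedComponentMk v = C}).ConnectedComponent
      - 2)

/-- A cycle `x_0 e_0 x_1 e_1 … x_k e_k x_0` (`k ≥ 1`) in the colored multigraph
determined by `Gm, Gy, Gc`: pairwise distinct vertices, each consecutive pair joined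
by an edge of the indicated color, and (in the case `k = 1`, where the two edges join
the same pair of vertices) the edges pairwise distinct. -/
structure ColCycle {V : Type*} (Gm Gy Gc : SimpleGraph V) where
  k : ℕ
  hk : 1 ≤ k
  x : Fin (k + 1) → V
  col : Fin (k + 1) → Col
  inj : Function.Injective x
  adj : ∀ i : Fin (k + 1), (colG Gm Gy Gc (col i)).Adj (x i) (x (i + 1))
  edges_distinct : k = 1 → col 0 ≠ col 1

/-- Functions constant along edges. -/
def WW {V : Type*} (G : SimpleGraph V) : Submodule ℚ (V → ℚ) where
  carrier := {f | ∀ u v, G.Adj u v → f u = f v}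
  add_mem' := by
    intro f g hf hg u v h
    simp [hf u v h, hg u v h]
  zero_mem' := by
    intro u v h
    rfl
  smul_mem' := by
    intro c f hf u v h
    simp [hf u v h]

theorem mem_WW {V : Type*} (G : SimpleGraph V) (f : V → ℚ) :
    f ∈ WW G ↔ ∀ u v, G.Adj u v → f u = f v := Iff.rfl

theorem WW_sup {V : Type*} (G H : SimpleGraph V) : WW (G ⊔ H) = WW G ⊓ WW H := by
  ext f
  simp only [Submodule.mem_inf, mem_WW, SimpleGraph.sup_adj]
  constructor
  · intro h
    exact ⟨fun u v q => h u v (Or.inl q), fun u v q => h u v (Or.inr q)⟩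
  · rintro ⟨h1, h2⟩ u v (q | q)
    · exact h1 u v q
    · exact h2 u v q

theorem WW_reach {V : Type*} (G : SimpleGraph V) (f : V → ℚ) (hf : f ∈ WW G) (u v : V)
    (h : G.Reachable u v) : f u = f v := by
  obtain ⟨p⟩ := h
  induction p with
  | nil => rfl
  | cons a p ih => exact (hf _ _ a).trans ih

open scoped Classical in
theorem finrank_WW {V : Type*} [Fintype V] (G : SimpleGraph V) :
    Module.finrank ℚ (WW G) = Fintype.card G.ConnectedComponent := by
  let e : (WW G) ≃ₗ[ℚ] (G.ConnectedComponent → ℚ) :=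
    { toFun := fun f => fun C => C.lift f.1 (fun u v p _ => WW_reach G f.1 f.2 u v ⟨p⟩)
      invFun := fun g => ⟨fun v => g (G.connectedComponentMk v), fun u v h => by
        exact congrArg g (SimpleGraph.ConnectedComponent.sound h.reachable)⟩
      left_inv := by
        intro f
        ext v
        rfl
      right_inv := by
        intro g
        ext C
        induction C using SimpleGraph.ConnectedComponent.ind
        rfl
      map_add' := by
        intro f g
        ext C
        induction C using SimpleGraph.ConnectedComponent.ind
        rfl
      map_smul' := by
        intro f g
        ext C
        induction C using SimpleGraph.ConnectedComponent.ind
        rfl }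
  rw [e.finrank_eq, Module.finrank_fintype_fun_eq_card]

open scoped Classical in
theorem card_split {V : Type*} [Fintype V] (G H : SimpleGraph V) (hle : H ≤ G) :
    ∑ C : G.ConnectedComponent, Fintype.card
      (H.induce {v : V | G.connectedComponentMk v = C}).ConnectedComponent
      = Fintype.card H.ConnectedComponent := by
  rw [← Fintype.card_sigma]
  let F : (Σ C : G.ConnectedComponent,
      (H.induce {v : V | G.connectedComponentMk v = C}).ConnectedComponent) →
      H.ConnectedComponent := fun D => D.2.map (SimpleGraph.Embedding.induce _).toHom
  apply Fintype.card_of_bijective (f := F)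
  constructor
  · rintro ⟨C, D⟩ ⟨C', D'⟩ h
    induction D using SimpleGraph.ConnectedComponent.ind with | _ u
    induction D' using SimpleGraph.ConnectedComponent.ind with | _ v
    obtain ⟨u, rfl⟩ := u
    obtain ⟨v, hv⟩ := v
    have h' : H.Reachable u v := SimpleGraph.ConnectedComponent.exact h
    have : G.connectedComponentMk u = C' := by
      rw [← hv]
      exact SimpleGraph.ConnectedComponent.sound (h'.mono hle)
    subst this
    congr 1
    apply SimpleGraph.ConnectedComponent.sound
    obtain ⟨p⟩ := h'
    refine ⟨p.induce _ ?_⟩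
    intro w hw
    exact SimpleGraph.ConnectedComponent.sound
      (SimpleGraph.Reachable.mono hle ⟨(p.takeUntil w hw).reverse⟩)
  · intro D
    induction D using SimpleGraph.ConnectedComponent.ind with | _ u
    exact ⟨⟨G.connectedComponentMk u, SimpleGraph.connectedComponentMk _ ⟨u, rfl⟩⟩, rfl⟩

theorem sum_aux {α : Type*} (i1 i2 i3 : Fintype α) (f g : α → ℕ) (h : ∀ a, f a + 2 = g a) :
    (@Finset.univ α i1).sum f + 2 * @Fintype.card α i2 = (@Finset.univ α i3).sum g := by
  obtain rfl := Subsingleton.elim i1 i2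
  obtain rfl := Subsingleton.elim i1 i3
  simp only [← h, Finset.sum_add_distrib]
  simp [mul_comm]

open scoped Classical in
theorem sigma_eq {V : Type*} [Fintype V] (Gm Gy Gc : SimpleGraph V) :
    SigmaFn Gm Gy Gc + 2 * Module.finrank ℚ (WW (Gm ⊔ Gy ⊔ Gc)) =
      Module.finrank ℚ (WW (Gm ⊔ Gy)) + Module.finrank ℚ (WW (Gy ⊔ Gc))
        + Module.finrank ℚ (WW (Gm ⊔ Gc)) := by
  simp only [finrank_WW]
  rw [← card_split (Gm ⊔ Gy ⊔ Gc) (Gm ⊔ Gy) le_sup_left,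
    ← card_split (Gm ⊔ Gy ⊔ Gc) (Gy ⊔ Gc) (by rw [sup_assoc]; exact le_sup_right),
    ← card_split (Gm ⊔ Gy ⊔ Gc) (Gm ⊔ Gc) (sup_le_sup_right le_sup_left _),
    ← Finset.sum_add_distrib, ← Finset.sum_add_distrib]
  unfold SigmaFn
  refine sum_aux _ _ _ _ _ ?_
  intro C
  simp only [Fintype.card_eq_nat_card]
  have key : ∀ H : SimpleGraph V, 1 ≤ Nat.card
      (H.induce {v : V | (Gm ⊔ Gy ⊔ Gc).connectedComponentMk v = C}).ConnectedComponent := by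
    intro H
    induction C using SimpleGraph.ConnectedComponent.ind with | _ u
    exact Nat.card_pos_iff.mpr ⟨⟨SimpleGraph.connectedComponentMk _ ⟨u, rfl⟩⟩, inferInstance⟩
  have h1 := key (Gm ⊔ Gy)
  have h2 := key (Gy ⊔ Gc)
  omega

theorem reach_of_cycles {V : Type*} (Gm Gy Gc : SimpleGraph V)
    (hc : ∀ c : ColCycle Gm Gy Gc, ∀ i j : Fin (c.k + 1), c.col i = c.col j)
    (a : Col) (H G' : SimpleGraph V)
    (hH : ∀ u v, H.Adj u v → ∃ b, b ≠ a ∧ (colG Gm Gy Gc b).Adj u v)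
    (hG' : G' ≤ colG Gm Gy Gc a) (u v : V) (huv : (colG Gm Gy Gc a).Adj u v)
    (hn : ¬ G'.Adj u v) (hr : (G' ⊔ H).Reachable u v) : G'.Reachable u v := by
  classical
  obtain ⟨p, hp⟩ := hr.exists_isPath
  have hstep : ∀ s t, ∃ b, (G' ⊔ H).Adj s t → (colG Gm Gy Gc b).Adj s t ∧
      (b = a → G'.Adj s t) := by
    intro s t
    by_cases h : (G' ⊔ H).Adj s t
    swap
    · exact ⟨a, fun q => absurd q h⟩
    by_cases h' : G'.Adj s t
    · exact ⟨a, fun _ => ⟨hG' h', fun _ => h'⟩⟩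
    · obtain ⟨b, hb, hb'⟩ := hH s t (h.resolve_left h')
      exact ⟨b, fun _ => ⟨hb', fun q => absurd q hb⟩⟩
  choose f hf using hstep
  have hf1 := fun s t h => (hf s t h).1
  have hf2 := fun s t h => (hf s t h).2
  have hlen : 1 ≤ p.length := by
    by_contra hlt
    have : p.length = 0 := by omega
    exact huv.ne (SimpleGraph.Walk.eq_of_length_eq_zero this)
  let c : ColCycle Gm Gy Gc :=
    { k := p.length
      hk := hlen
      x := fun i => p.getVert i
      col := fun i => if (i : ℕ) < p.length then f (p.getVert i) (p.getVert (i + 1)) else a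
      inj := by
        intro i j h
        exact Fin.ext (hp.getVert_injOn (Nat.lt_succ_iff.mp i.2) (Nat.lt_succ_iff.mp j.2) h)
      adj := by
        intro i
        by_cases hi : (i : ℕ) < p.length
        · have : ((i + 1 : Fin (p.length + 1)) : ℕ) = i + 1 := by
            apply Fin.val_add_one_of_lt
            exact hi
          simp only [hi, if_true, this]
          exact hf1 _ _ (p.adj_getVert_succ hi)
        · have hi' : i = Fin.last _ := by
            apply Fin.ext
            simp
            omega
          subst hi'
          simp
          exact huv.symm
      edges_distinct := by
        intro h1
        have e0 : ((0 : Fin (p.length + 1)) : ℕ) = 0 := rfl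
        have e1 : ((1 : Fin (p.length + 1)) : ℕ) = 1 := by
          rw [Fin.val_one']; exact Nat.mod_eq_of_lt (by omega)
        simp only [e0, e1, h1]
        simp only [zero_add, lt_irrefl, if_false, Nat.lt_one_iff, if_true]
        intro hfa
        have := p.adj_getVert_succ (i := 0) (by omega)
        have := hf2 _ _ this hfa
        apply hn
        have hv : p.getVert 1 = v := by rw [← h1]; simp
        simpa [hv] using this }
  have hall : ∀ i, i < p.length → G'.Adj (p.getVert i) (p.getVert (i + 1)) := by
    intro i hi
    have := hc c ⟨i, Nat.lt_succ_of_lt hi⟩ (Fin.last _)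
    simp [c, hi] at this
    exact hf2 _ _ (p.adj_getVert_succ hi) this
  have hind : ∀ i, i ≤ p.length → G'.Reachable u (p.getVert i) := by
    intro i
    induction i with
    | zero => intro _; simp
    | succ i ih => intro h; exact (ih (by omega)).trans (hall i (by omega)).reachable
  simpa using hind p.length le_rfl

theorem top_of_reach {V : Type*} [Fintype V] (G H : SimpleGraph V)
    (h : ∀ G' ≤ G, ∀ u v, G.Adj u v → ¬ G'.Adj u v → (G' ⊔ H).Reachable u v → G'.Reachable u v) :
    WW G ⊔ WW H = ⊤ := by
  classical
  suffices key : ∀ n, ∀ G' ≤ G, G'.edgeFinset.card = n → WW G' ⊔ WW H = ⊤ from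
    key _ G le_rfl rfl
  intro n
  induction n with
  | zero =>
    intro G' _ h0
    have : G' = ⊥ := by
      simpa using h0
    subst this
    have : WW (⊥ : SimpleGraph V) = ⊤ := by
      rw [eq_top_iff]
      intro f _ u v h
      exact absurd h (by simp)
    rw [this, top_sup_eq]
  | succ n ih =>
    intro G₁ hG₁ hcard
    obtain ⟨e, he⟩ : G₁.edgeFinset.Nonempty := by
      rw [← Finset.card_pos]; omega
    induction e using Sym2.ind with | _ u v
    have huv : G₁.Adj u v := by simpa using he
    let G₂ := G₁.deleteEdges {s(u, v)}
    have hle : G₂ ≤ G₁ := SimpleGraph.deleteEdges_le _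
    have hn : ¬ G₂.Adj u v := by simp [G₂]
    have hE : G₂.edgeFinset = G₁.edgeFinset.erase s(u, v) := by
      ext e
      simp [G₂, SimpleGraph.edgeSet_deleteEdges, and_comm]
    have h2 : WW G₂ ⊔ WW H = ⊤ := by
      apply ih G₂ (hle.trans hG₁)
      have hc2 := congrArg Finset.card hE
      rw [Finset.card_erase_of_mem he, hcard] at hc2
      rw [Nat.add_sub_cancel] at hc2
      rw [← hc2]
      congr!
    have hext : ∀ g : V → ℚ, g ∈ WW G₂ → g u = g v → g ∈ WW G₁ := by
      intro g hg hgu s t hst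
      by_cases hh : s(s, t) = s(u, v)
      · rw [Sym2.eq_iff] at hh
        rcases hh with ⟨rfl, rfl⟩ | ⟨rfl, rfl⟩
        · exact hgu
        · exact hgu.symm
      · exact hg s t (by simp only [G₂, SimpleGraph.deleteEdges_adj]; exact ⟨hst, hh⟩)
    rw [eq_top_iff]
    intro f _
    have hf : f ∈ WW G₂ ⊔ WW H := by rw [h2]; trivial
    obtain ⟨g, hg, k, hk, rfl⟩ := Submodule.mem_sup.mp hf
    by_cases hr : (G₂ ⊔ H).Reachable u v
    · have := h G₂ (hle.trans hG₁) u v (hG₁ huv) hn hr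
      exact Submodule.mem_sup.mpr ⟨g, hext g hg (WW_reach _ g hg u v this), k, hk, rfl⟩
    · let s : V → ℚ := fun w => if (G₂ ⊔ H).Reachable w v then g v - g u else 0
      have hs : s ∈ WW (G₂ ⊔ H) := by
        intro a b hab
        have : (G₂ ⊔ H).Reachable a v ↔ (G₂ ⊔ H).Reachable b v :=
          ⟨fun q => hab.reachable.symm.trans q, fun q => hab.reachable.trans q⟩
        simp only [s, this]
      rw [WW_sup] at hs
      refine Submodule.mem_sup.mpr ⟨g - s, hext _ (Submodule.sub_mem _ hg hs.1) ?_, k + s,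
        Submodule.add_mem _ hk hs.2, by abel⟩
      simp [s, hr]

theorem cycles_of_top {V : Type*} (Gm Gy Gc : SimpleGraph V)
    (h : ∀ a : Col, ∃ H : SimpleGraph V, (∀ b, b ≠ a → colG Gm Gy Gc b ≤ H) ∧
      WW (colG Gm Gy Gc a) ⊔ WW H = ⊤)
    (c : ColCycle Gm Gy Gc) (i j : Fin (c.k + 1)) : c.col i = c.col j := by
  classical
  suffices hs : ∀ j, c.col j = c.col (j + 1) by
    have h0 : ∀ i, c.col i = c.col 0 := by
      intro i
      induction i using Fin.induction with
      | zero => rfl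
      | succ i ih => rw [← ih, hs i.castSucc, Fin.coeSucc_eq_succ]
    rw [h0 i, h0 j]
  intro j
  by_contra hne
  obtain ⟨H, hH, htop⟩ := h (c.col (j + 1))
  set a := c.col (j + 1) with ha
  have hzero : ∀ f : V → ℚ,
      ∑ i : Fin (c.k + 1), (if c.col i = a then f (c.x (i + 1)) - f (c.x i) else 0) = 0 := by
    intro f
    have hf : f ∈ WW (colG Gm Gy Gc a) ⊔ WW H := by rw [htop]; trivial
    obtain ⟨g, hg, k, hk, rfl⟩ := Submodule.mem_sup.mp hf
    have e : ∀ i : Fin (c.k + 1), (if c.col i = a then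
        (g + k) (c.x (i + 1)) - (g + k) (c.x i) else 0) = k (c.x (i + 1)) - k (c.x i) := by
      intro i
      have hadj := c.adj i
      split_ifs with hi
      · rw [hi] at hadj
        have := hg _ _ hadj
        simp [this]
      · have := hk _ _ (hH _ hi hadj)
        rw [this, sub_self]
    rw [Finset.sum_congr rfl (fun i _ => e i), Finset.sum_sub_distrib, sub_eq_zero]
    exact Equiv.sum_comp (Equiv.addRight (1 : Fin (c.k + 1))) (fun i => k (c.x i))
  have := hzero (fun w => if w = c.x (j + 1) then 1 else 0)
  rw [Finset.sum_eq_single (j + 1)] at this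
  · have hk := c.hk
    have hne1 : j + 1 + 1 ≠ j + 1 := by
      intro q
      have q1 : (1 : Fin (c.k + 1)) = 0 := by simpa using q
      have := congrArg Fin.val q1
      rw [Fin.val_one'] at this
      simp at this
      omega
    have : c.x (j + 1 + 1) ≠ c.x (j + 1) := fun q => hne1 (c.inj q)
    simp_all
  · intro i _ hi
    split_ifs with hia q1 q2 q2
    · exact absurd (c.inj q2) hi
    · have := c.inj q1
      have : i = j := by simpa using this
      subst this
      exact absurd hia hne
    · exact absurd (c.inj q2) hi
    · simp
    · rfl
  · simp

theorem stmt_13 {V : Type*} [Fintype V] (Gm Gy Gc : SimpleGraph V) :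
    SigmaFn Gm Gy Gc = Fintype.card V ↔
      ∀ c : ColCycle Gm Gy Gc, ∀ i j : Fin (c.k + 1), c.col i = c.col j := by
  have hS := sigma_eq Gm Gy Gc
  have hV : Module.finrank ℚ (V → ℚ) = Fintype.card V := Module.finrank_fintype_fun_eq_card ℚ
  have d := fun A B : Submodule ℚ (V → ℚ) => Submodule.finrank_sup_add_finrank_inf_eq A B
  have i1 : WW Gm ⊓ WW (Gy ⊔ Gc) = WW (Gm ⊔ Gy ⊔ Gc) := by rw [← WW_sup, sup_assoc]
  have i2 : WW Gy ⊓ WW (Gm ⊔ Gc) = WW (Gm ⊔ Gy ⊔ Gc) := by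
    rw [← WW_sup, sup_left_comm, sup_assoc]
  have i3 : WW Gc ⊓ WW (Gm ⊔ Gy) = WW (Gm ⊔ Gy ⊔ Gc) := by rw [← WW_sup, sup_comm]
  have d1 := d (WW Gm) (WW (Gy ⊔ Gc))
  have d2 := d (WW Gy) (WW (Gm ⊔ Gc))
  have d3 := d (WW Gc) (WW (Gm ⊔ Gy))
  rw [i1] at d1
  rw [i2] at d2
  rw [i3] at d3
  constructor
  · intro hn
    have sub : ∀ A B C : SimpleGraph V, WW (A ⊔ B) ⊔ WW (A ⊔ C) ≤ WW A := by
      intro A B C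
      rw [WW_sup, WW_sup]
      exact sup_le inf_le_left inf_le_left
    have j : ∀ A B C : SimpleGraph V, Module.finrank ℚ (WW (A ⊔ B)) + Module.finrank ℚ (WW (A ⊔ C))
        ≤ Module.finrank ℚ (WW A) + Module.finrank ℚ (WW (A ⊔ B ⊔ C)) := by
      intro A B C
      rw [← d (WW (A ⊔ B)) (WW (A ⊔ C)), ← WW_sup, ← sup_sup_distrib_left, ← sup_assoc]
      exact Nat.add_le_add_right (Submodule.finrank_mono (sub A B C)) _
    have j1 := j Gm Gy Gc
    have j2 := j Gy Gm Gc
    have j3 := j Gc Gm Gy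
    rw [sup_comm Gy Gm] at j2
    rw [sup_comm Gc Gm, sup_comm Gc Gy, sup_right_comm] at j3
    have t : ∀ A : Submodule ℚ (V → ℚ), Fintype.card V ≤ Module.finrank ℚ A → A = ⊤ := by
      intro A hA
      apply Submodule.eq_top_of_finrank_eq
      have := Submodule.finrank_le A
      omega
    apply cycles_of_top
    intro a
    cases a
    · refine ⟨Gy ⊔ Gc, ?_, t _ ?_⟩
      · intro b hb
        cases b
        · exact absurd rfl hb
        · exact le_sup_left
        · exact le_sup_right
      · refine le_of_le_of_eq ?_ (show _ = _ from rfl : Module.finrank ℚ ↥(WW Gm ⊔ WW (Gy ⊔ Gc)) = _)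
        omega
    · refine ⟨Gm ⊔ Gc, ?_, t _ ?_⟩
      · intro b hb
        cases b
        · exact le_sup_left
        · exact absurd rfl hb
        · exact le_sup_right
      · refine le_of_le_of_eq ?_ (show _ = _ from rfl : Module.finrank ℚ ↥(WW Gy ⊔ WW (Gm ⊔ Gc)) = _)
        omega
    · refine ⟨Gm ⊔ Gy, ?_, t _ ?_⟩
      · intro b hb
        cases b
        · exact le_sup_left
        · exact le_sup_right
        · exact absurd rfl hb
      · refine le_of_le_of_eq ?_ (show _ = _ from rfl : Module.finrank ℚ ↥(WW Gc ⊔ WW (Gm ⊔ Gy)) = _)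
        omega
  · intro hc
    have t1 : WW Gm ⊔ WW (Gy ⊔ Gc) = ⊤ := by
      apply top_of_reach
      intro G' hG' u v
      apply reach_of_cycles Gm Gy Gc hc Col.magenta (Gy ⊔ Gc) G' _ hG'
      rintro u v (h | h)
      · exact ⟨Col.yellow, by simp, h⟩
      · exact ⟨Col.cyan, by simp, h⟩
    have t2 : WW Gy ⊔ WW (Gm ⊔ Gc) = ⊤ := by
      apply top_of_reach
      intro G' hG' u v
      apply reach_of_cycles Gm Gy Gc hc Col.yellow (Gm ⊔ Gc) G' _ hG'
      rintro u v (h | h)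
      · exact ⟨Col.magenta, by simp, h⟩
      · exact ⟨Col.cyan, by simp, h⟩
    have t3 : WW Gm ⊔ WW Gy = ⊤ := by
      rw [eq_top_iff, ← t1, WW_sup]
      exact sup_le_sup_left inf_le_left _
    have d4 := d (WW Gm) (WW Gy)
    rw [t3, ← WW_sup, finrank_top] at d4
    rw [t1, finrank_top] at d1
    rw [t2, finrank_top] at d2
    omega
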